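/- The logic HLC♭ has the finite model property and is strongly complete with respect to the class of flat frames: (i) for all Γ ∪ {φ} ⊆ L⇛, if every flat frame validates the consecution Γ ⇒ φ then Γ ⊢ φ; (ii) every finite consecution Γ ⇒ φ with Γ ⊬ φ is refuted by some finite flat model. -/

import Mathlib

/-- Formulas of the language `L⇛`. -/
inductive Fml : Type where
  | var : Nat → Fml
  | top : Fml
  | bot : Fml
  | and : Fml → Fml → Fml
  | or  : Fml → Fml → Fml
  | imp : Fml → Fml → Fml
  | sto : Fml → Fml → Fml
deriving DecidableEq

/-- Uniform substitution. -/
def Fml.subst (σ : Nat → Fml) : Fml → Fml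
  | .var p => σ p
  | .top => .top
  | .bot => .bot
  | .and φ ψ => .and (φ.subst σ) (ψ.subst σ)
  | .or φ ψ => .or (φ.subst σ) (ψ.subst σ)
  | .imp φ ψ => .imp (φ.subst σ) (ψ.subst σ)
  | .sto φ ψ => .sto (φ.subst σ) (ψ.subst σ)

/-- Conjunction `φ₁ ∧ ⋯ ∧ φₙ` of a list of formulas (`⊤` for the empty list). -/
def Fml.conj : List Fml → Fml
  | [] => .top
  | [φ] => φ
  | φ :: ψ :: rest => .and φ (Fml.conj (ψ :: rest))

/-- Disjunction `φ₁ ∨ ⋯ ∨ φₙ` of a list of formulas (`⊥` for the empty list). -/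
def Fml.disj : List Fml → Fml
  | [] => .bot
  | [φ] => φ
  | φ :: ψ :: rest => .or φ (Fml.disj (ψ :: rest))

/-- Axiom schemes of intuitionistic propositional logic (a standard Hilbert-style
axiomatisation); as schemes, they comprise all substitution instances. -/
inductive IpcAx : Fml → Prop where
  | k (φ ψ : Fml) : IpcAx (.imp φ (.imp ψ φ))
  | s (φ ψ χ : Fml) : IpcAx (.imp (.imp φ (.imp ψ χ)) (.imp (.imp φ ψ) (.imp φ χ)))
  | andE1 (φ ψ : Fml) : IpcAx (.imp (.and φ ψ) φ)
  | andE2 (φ ψ : Fml) : IpcAx (.imp (.and φ ψ) ψ)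
  | andI (φ ψ : Fml) : IpcAx (.imp φ (.imp ψ (.and φ ψ)))
  | orI1 (φ ψ : Fml) : IpcAx (.imp φ (.or φ ψ))
  | orI2 (φ ψ : Fml) : IpcAx (.imp ψ (.or φ ψ))
  | orE (φ ψ χ : Fml) : IpcAx (.imp (.imp φ χ) (.imp (.imp ψ χ) (.imp (.or φ ψ) χ)))
  | botE (φ : Fml) : IpcAx (.imp .bot φ)
  | top : IpcAx .top

/-- Substitution instances of the axioms of intuitionistic logic together with
`k_a : ((p⇛q)∧(p⇛r))→(p⇛(q∧r))` and `tr : ((p⇛q)∧(q⇛r))→(p⇛r)`. -/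
inductive BaseAx : Fml → Prop where
  | ipc {φ : Fml} : IpcAx φ → BaseAx φ
  | ka (φ ψ χ : Fml) : BaseAx (.imp (.and (.sto φ ψ) (.sto φ χ)) (.sto φ (.and ψ χ)))
  | tr (φ ψ χ : Fml) : BaseAx (.imp (.and (.sto φ ψ) (.sto ψ χ)) (.sto φ χ))

/-- Derivability of the consecution `Γ ⇒ φ` in `HLC♭ ⊕ Ax`, i.e. `Γ ⊢_Ax φ`. -/
inductive Deriv (Ax : Set Fml) : Set Fml → Fml → Prop where
  | base {Γ : Set Fml} {φ : Fml} : BaseAx φ → Deriv Ax Γ φ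
  | axm {Γ : Set Fml} {ψ : Fml} (σ : Nat → Fml) : ψ ∈ Ax → Deriv Ax Γ (ψ.subst σ)
  | el {Γ : Set Fml} {φ : Fml} : φ ∈ Γ → Deriv Ax Γ φ
  | mp {Γ : Set Fml} {φ ψ : Fml} : Deriv Ax Γ φ → Deriv Ax Γ (.imp φ ψ) → Deriv Ax Γ ψ
  | na {Γ : Set Fml} {φ ψ : Fml} : Deriv Ax (∅ : Set Fml) (.imp φ ψ) → Deriv Ax Γ (.sto φ ψ)

/-- A flat frame: a nonempty set of worlds with a preorder `≼` and a relation `R`. -/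
structure FlatFrame : Type 1 where
  W : Type
  ne : Nonempty W
  le : W → W → Prop
  le_refl : ∀ w, le w w
  le_trans : ∀ ⦃w v u⦄, le w v → le v u → le w u
  R : W → W → Prop

/-- A valuation is admissible if every proposition letter denotes an upset. -/
def FlatFrame.IsUpset (F : FlatFrame) (V : Nat → F.W → Prop) : Prop :=
  ∀ p ⦃w v⦄, F.le w v → V p w → V p v

/-- Truth of a formula at a world of a flat model: the usual intuitionistic Kripke
clauses over `≼`, and `w ⊨ φ⇛ψ` iff for every `w' ≽ w`, `R[w'] ⊆ ⟦φ⟧` implies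
`R[w'] ⊆ ⟦ψ⟧`. -/
def FlatFrame.sat (F : FlatFrame) (V : Nat → F.W → Prop) : Fml → F.W → Prop
  | .var p, w => V p w
  | .top, _ => True
  | .bot, _ => False
  | .and φ ψ, w => F.sat V φ w ∧ F.sat V ψ w
  | .or φ ψ, w => F.sat V φ w ∨ F.sat V ψ w
  | .imp φ ψ, w => ∀ v, F.le w v → F.sat V φ v → F.sat V ψ v
  | .sto φ ψ, w => ∀ w', F.le w w' →
      (∀ v, F.R w' v → F.sat V φ v) → ∀ v, F.R w' v → F.sat V ψ v

/-- A flat frame validates the consecution `Γ ⇒ φ` if in every model on it, every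
world satisfying all formulas of `Γ` satisfies `φ`. -/
def FlatFrame.ValidCons (F : FlatFrame) (Γ : Set Fml) (φ : Fml) : Prop :=
  ∀ V, F.IsUpset V → ∀ w, (∀ ψ ∈ Γ, F.sat V ψ w) → F.sat V φ w

/-- A flat frame validates a formula if it is true at every world in every model on it. -/
def FlatFrame.ValidFml (F : FlatFrame) (φ : Fml) : Prop :=
  ∀ V, F.IsUpset V → ∀ w, F.sat V φ w

namespace Deriv

variable {Ax Γ Δ : Set Fml} {φ ψ χ : Fml}

theorem mono (h : Deriv Ax Γ φ) (hs : Γ ⊆ Δ) : Deriv Ax Δ φ := by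
  induction h with
  | base h => exact .base h
  | axm σ h => exact .axm σ h
  | el h => exact .el (hs h)
  | mp _ _ ih₁ ih₂ => exact .mp (ih₁ hs) (ih₂ hs)
  | na h _ => exact .na h

theorem weaken (h : Deriv Ax Γ ψ) : Deriv Ax Γ (.imp φ ψ) :=
  .mp h (.base (.ipc (.k _ _)))

theorem imp_self : Deriv Ax Γ (.imp φ φ) :=
  .mp (.base (.ipc (.k φ φ))) (.mp (.base (.ipc (.k φ (.imp φ φ)))) (.base (.ipc (.s _ _ _))))

theorem deduction (h : Deriv Ax (insert φ Γ) ψ) : Deriv Ax Γ (.imp φ ψ) := by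
  generalize hΔ : insert φ Γ = Δ at h
  induction h with
  | base h => exact weaken (.base h)
  | axm σ h => exact weaken (.axm σ h)
  | el h =>
    subst hΔ
    rcases h with rfl | h
    · exact imp_self
    · exact weaken (.el h)
  | mp _ _ ih₁ ih₂ => exact .mp (ih₁ hΔ) (.mp (ih₂ hΔ) (.base (.ipc (.s _ _ _))))
  | na h _ => exact weaken (.na h)

theorem and_intro (h₁ : Deriv Ax Γ φ) (h₂ : Deriv Ax Γ ψ) : Deriv Ax Γ (.and φ ψ) :=
  .mp h₂ (.mp h₁ (.base (.ipc (.andI _ _))))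

theorem sto_trans (h₁ : Deriv Ax Γ (.sto φ ψ)) (h₂ : Deriv Ax Γ (.sto ψ χ)) :
    Deriv Ax Γ (.sto φ χ) :=
  .mp (and_intro h₁ h₂) (.base (.tr _ _ _))

theorem sto_and (h₁ : Deriv Ax Γ (.sto φ ψ)) (h₂ : Deriv Ax Γ (.sto φ χ)) :
    Deriv Ax Γ (.sto φ (.and ψ χ)) :=
  .mp (and_intro h₁ h₂) (.base (.ka _ _ _))

/-- The consequences of `φ` under `⇛` are closed under derivability. -/
theorem sto_of_deriv (h : Deriv Ax {χ | Deriv Ax Γ (.sto φ χ)} ψ) : Deriv Ax Γ (.sto φ ψ) := by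
  generalize hΔ : {χ | Deriv Ax Γ (.sto φ χ)} = Δ at h
  induction h with
  | base h => exact .na (weaken (.base h))
  | axm σ h => exact .na (weaken (.axm σ h))
  | el h => subst hΔ; exact h
  | @mp _ a b _ _ ih₁ ih₂ =>
    refine sto_trans (sto_and (ih₁ hΔ) (ih₂ hΔ)) (.na (deduction ?_))
    have h : Deriv Ax (insert (.and a (.imp a b)) ∅) (.and a (.imp a b)) := .el (by simp)
    exact .mp (.mp h (.base (.ipc (.andE1 _ _)))) (.mp h (.base (.ipc (.andE2 _ _))))
  | na h _ => exact .na (weaken (.na h))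

/-- Derivability is finitary, stated for unions of chains. -/
theorem of_sUnion_chain {c : Set (Set Fml)} (hc : IsChain (· ⊆ ·) c) (hne : c.Nonempty)
    (h : Deriv Ax (⋃₀ c) φ) : ∃ Γ ∈ c, Deriv Ax Γ φ := by
  generalize hΔ : ⋃₀ c = Δ at h
  induction h with
  | base h => exact hne.imp fun _ hs => ⟨hs, .base h⟩
  | axm σ h => exact hne.imp fun _ hs => ⟨hs, .axm σ h⟩
  | el h =>
    subst hΔ
    obtain ⟨s, hs, h⟩ := h
    exact ⟨s, hs, .el h⟩
  | mp _ _ ih₁ ih₂ =>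
    obtain ⟨s, hs, h₁⟩ := ih₁ hΔ
    obtain ⟨t, ht, h₂⟩ := ih₂ hΔ
    rcases hc.total hs ht with hst | hts
    · exact ⟨t, ht, .mp (h₁.mono hst) h₂⟩
    · exact ⟨s, hs, .mp h₁ (h₂.mono hts)⟩
  | na h _ => exact hne.imp fun _ hs => ⟨hs, .na h⟩

end Deriv

/-- A consistent, deductively closed set of formulas with the disjunction property. -/
structure IsPrimeTheory (Ax Δ : Set Fml) : Prop where
  closed : ∀ φ, Deriv Ax Δ φ → φ ∈ Δ
  bot : Fml.bot ∉ Δ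
  or : ∀ φ ψ, Fml.or φ ψ ∈ Δ → φ ∈ Δ ∨ ψ ∈ Δ

/-- Lindenbaum's lemma for prime theories. -/
theorem exists_isPrimeTheory {Ax Γ : Set Fml} {φ : Fml} (h : ¬ Deriv Ax Γ φ) :
    ∃ Δ, Γ ⊆ Δ ∧ IsPrimeTheory Ax Δ ∧ φ ∉ Δ := by
  obtain ⟨Δ, hΓ, hΔ⟩ := zorn_subset_nonempty {Δ | ¬ Deriv Ax Δ φ}
    (fun c hcs hc hne => ⟨⋃₀ c, fun hd => by
      obtain ⟨s, hs, hd⟩ := hd.of_sUnion_chain hc hne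
      exact hcs hs hd, fun s hs => Set.subset_sUnion_of_mem hs⟩) Γ h
  have hφ : ¬ Deriv Ax Δ φ := hΔ.prop
  have key : ∀ χ, χ ∉ Δ → Deriv Ax Δ (.imp χ φ) := fun χ hχ => by
    by_contra hn
    exact hχ (hΔ.le_of_ge (y := insert χ Δ) (fun hd => hn hd.deduction)
      (Set.subset_insert _ _) (Set.mem_insert _ _))
  refine ⟨Δ, hΓ, ⟨fun χ hχ => ?_, fun hb => ?_, fun a b hab => ?_⟩, fun hm => hφ (.el hm)⟩
  · by_contra hn
    exact hφ (.mp hχ (key χ hn))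
  · exact hφ (.mp (.el hb) (.base (.ipc (.botE _))))
  · by_contra! hn
    exact hφ (.mp (.el hab) (.mp (key b hn.2) (.mp (key a hn.1) (.base (.ipc (.orE _ _ _))))))

/-- The set of subformulas of a formula. -/
def Fml.subformulas : Fml → Set Fml
  | .var p => {.var p}
  | .top => {.top}
  | .bot => {.bot}
  | .and φ ψ => insert (.and φ ψ) (φ.subformulas ∪ ψ.subformulas)
  | .or φ ψ => insert (.or φ ψ) (φ.subformulas ∪ ψ.subformulas)
  | .imp φ ψ => insert (.imp φ ψ) (φ.subformulas ∪ ψ.subformulas)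
  | .sto φ ψ => insert (.sto φ ψ) (φ.subformulas ∪ ψ.subformulas)

theorem Fml.self_mem_subformulas (φ : Fml) : φ ∈ φ.subformulas := by
  cases φ <;> simp [Fml.subformulas]

theorem Fml.finite_subformulas (φ : Fml) : φ.subformulas.Finite := by
  induction φ <;> simp_all [Fml.subformulas]

/-- Closure of a set of formulas under immediate subformulas. -/
structure SubformulaClosed (S : Set Fml) : Prop where
  and : ∀ ⦃φ ψ⦄, Fml.and φ ψ ∈ S → φ ∈ S ∧ ψ ∈ S
  or : ∀ ⦃φ ψ⦄, Fml.or φ ψ ∈ S → φ ∈ S ∧ ψ ∈ S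
  imp : ∀ ⦃φ ψ⦄, Fml.imp φ ψ ∈ S → φ ∈ S ∧ ψ ∈ S
  sto : ∀ ⦃φ ψ⦄, Fml.sto φ ψ ∈ S → φ ∈ S ∧ ψ ∈ S

theorem Fml.subformulaClosed_subformulas (χ : Fml) : SubformulaClosed χ.subformulas := by
  have self := Fml.self_mem_subformulas
  induction χ with
  | var | top | bot => constructor <;> simp [Fml.subformulas]
  | and a b iha ihb | or a b iha ihb | imp a b iha ihb | sto a b iha ihb =>
    obtain ⟨ha₁, ha₂, ha₃, ha₄⟩ := iha
    obtain ⟨hb₁, hb₂, hb₃, hb₄⟩ := ihb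
    constructor <;> intro φ ψ h <;>
      simp only [Fml.subformulas, Set.mem_insert_iff, Set.mem_union] at h ⊢ <;> grind

theorem SubformulaClosed.biUnion (A : Set Fml) :
    SubformulaClosed (⋃ χ ∈ A, χ.subformulas) := by
  have h := Fml.subformulaClosed_subformulas
  constructor <;> intro φ ψ hm <;> simp only [Set.mem_iUnion] at hm ⊢ <;>
    obtain ⟨χ, hχ, hm⟩ := hm
  · exact ⟨⟨χ, hχ, ((h χ).and hm).1⟩, ⟨χ, hχ, ((h χ).and hm).2⟩⟩
  · exact ⟨⟨χ, hχ, ((h χ).or hm).1⟩, ⟨χ, hχ, ((h χ).or hm).2⟩⟩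
  · exact ⟨⟨χ, hχ, ((h χ).imp hm).1⟩, ⟨χ, hχ, ((h χ).imp hm).2⟩⟩
  · exact ⟨⟨χ, hχ, ((h χ).sto hm).1⟩, ⟨χ, hχ, ((h χ).sto hm).2⟩⟩

/-- A world of the canonical model over `S`: the trace on `S` of a prime theory, paired with a
set of formulas closed under derivability within `S` and under the arrows `φ⇛ψ` of that theory. -/
structure IsCanonicalWorld (Ax S : Set Fml) (w : Set Fml × Set Fml) : Prop where
  prime : ∃ Δ, IsPrimeTheory Ax Δ ∧ w.1 = Δ ∩ S
  subset : w.2 ⊆ S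
  closed : ∀ φ ∈ S, Deriv Ax w.2 φ → φ ∈ w.2
  sto : ∀ φ ψ, Fml.sto φ ψ ∈ w.1 → φ ∈ w.2 → ψ ∈ w.2

/-- The canonical flat frame over `S`. -/
def canonicalFrame (Ax S : Set Fml) (ne : Nonempty {w // IsCanonicalWorld Ax S w}) :
    FlatFrame where
  W := {w // IsCanonicalWorld Ax S w}
  ne := ne
  le w v := w.1.1 ⊆ v.1.1
  le_refl _ := subset_rfl
  le_trans _ _ _ := subset_trans
  R w v := w.1.2 ⊆ v.1.1

/-- The canonical valuation. -/
def canonicalVal (Ax S : Set Fml) (ne : Nonempty {w // IsCanonicalWorld Ax S w}) (p : Nat)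
    (w : (canonicalFrame Ax S ne).W) : Prop :=
  Fml.var p ∈ w.1.1

theorem SubformulaClosed.isCanonicalWorld {Ax S Δ : Set Fml} (hS : SubformulaClosed S)
    (hΔ : IsPrimeTheory Ax Δ) : IsCanonicalWorld Ax S (Δ ∩ S, S) :=
  ⟨⟨Δ, hΔ, rfl⟩, subset_rfl, fun _ h _ => h, fun _ _ h _ => (hS.sto h.2).2⟩

theorem canonicalFrame_sat_iff {Ax S : Set Fml} (hS : SubformulaClosed S)
    (ne : Nonempty {w // IsCanonicalWorld Ax S w}) {φ : Fml} (hφ : φ ∈ S)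
    (w : (canonicalFrame Ax S ne).W) :
    (canonicalFrame Ax S ne).sat (canonicalVal Ax S ne) φ w ↔ φ ∈ w.1.1 := by
  induction φ generalizing w with
  | var p => rfl
  | top =>
    obtain ⟨Δ, hΔ, hw⟩ := w.2.prime
    rw [hw]
    exact ⟨fun _ => ⟨hΔ.closed _ (.base (.ipc .top)), hφ⟩, fun _ => trivial⟩
  | bot =>
    obtain ⟨Δ, hΔ, hw⟩ := w.2.prime
    rw [hw]
    exact ⟨False.elim, fun h => hΔ.bot h.1⟩
  | and a b iha ihb =>
    obtain ⟨Δ, hΔ, hw⟩ := w.2.prime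
    have hab := hS.and hφ
    simp only [FlatFrame.sat, iha hab.1, ihb hab.2, hw]
    exact ⟨fun h => ⟨hΔ.closed _ (.and_intro (.el h.1.1) (.el h.2.1)), hφ⟩, fun h =>
      ⟨⟨hΔ.closed _ (.mp (.el h.1) (.base (.ipc (.andE1 _ _)))), hab.1⟩,
        ⟨hΔ.closed _ (.mp (.el h.1) (.base (.ipc (.andE2 _ _)))), hab.2⟩⟩⟩
  | or a b iha ihb =>
    obtain ⟨Δ, hΔ, hw⟩ := w.2.prime
    have hab := hS.or hφ
    simp only [FlatFrame.sat, iha hab.1, ihb hab.2, hw]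
    constructor
    · rintro (h | h)
      · exact ⟨hΔ.closed _ (.mp (.el h.1) (.base (.ipc (.orI1 _ _)))), hφ⟩
      · exact ⟨hΔ.closed _ (.mp (.el h.1) (.base (.ipc (.orI2 _ _)))), hφ⟩
    · exact fun h => (hΔ.or _ _ h.1).imp (⟨·, hab.1⟩) (⟨·, hab.2⟩)
  | imp a b iha ihb =>
    have hab := hS.imp hφ
    simp only [FlatFrame.sat, iha hab.1, ihb hab.2]
    constructor
    · intro h
      obtain ⟨Δ, hΔ, hw⟩ := w.2.prime
      rw [hw]
      refine ⟨?_, hφ⟩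
      by_contra hn
      obtain ⟨Θ, hΘ, hp, hb⟩ := exists_isPrimeTheory (Γ := insert a Δ) (φ := b)
        fun hd => hn (hΔ.closed _ hd.deduction)
      refine hb (h ⟨_, hS.isCanonicalWorld hp⟩ ?_ ⟨hΘ (Set.mem_insert _ _), hab.1⟩).1
      change w.1.1 ⊆ Θ ∩ S
      rw [hw]
      exact Set.inter_subset_inter_left _ ((Set.subset_insert _ _).trans hΘ)
    · intro h v hv ha
      obtain ⟨Θ, hΘ, hv'⟩ := v.2.prime
      have h' := hv h
      rw [hv'] at h' ha ⊢
      exact ⟨hΘ.closed _ (.mp (.el ha.1) (.el h'.1)), hab.2⟩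
  | sto a b iha ihb =>
    have hab := hS.sto hφ
    simp only [FlatFrame.sat, iha hab.1, ihb hab.2]
    have box : ∀ (v : (canonicalFrame Ax S ne).W) (χ : Fml), χ ∈ S →
        ((∀ u, (canonicalFrame Ax S ne).R v u → χ ∈ u.1.1) ↔ χ ∈ v.1.2) := by
      refine fun v χ hχ => ⟨fun h => ?_, fun h u hu => hu h⟩
      by_contra hn
      obtain ⟨Θ, hΘ, hp, hb⟩ := exists_isPrimeTheory fun hd => hn (v.2.closed χ hχ hd)
      exact hb (h ⟨_, hS.isCanonicalWorld hp⟩ (Set.subset_inter hΘ v.2.subset)).1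
    simp only [box _ a hab.1, box _ b hab.2]
    refine ⟨fun h => ?_, fun h v hv => v.2.sto _ _ (hv h)⟩
    obtain ⟨Δ, hΔ, hw⟩ := w.2.prime
    have hT : IsCanonicalWorld Ax S (w.1.1, {χ | Deriv Ax Δ (.sto a χ)} ∩ S) := by
      refine ⟨⟨Δ, hΔ, hw⟩, Set.inter_subset_right, fun χ hχ hd => ⟨?_, hχ⟩, ?_⟩
      · exact (hd.mono Set.inter_subset_left).sto_of_deriv
      · intro c d hcd hc
        have hcd' : Fml.sto c d ∈ Δ ∩ S := hw ▸ hcd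
        exact ⟨.sto_trans hc.1 (.el hcd'.1), (hS.sto hcd'.2).2⟩
    have hb := h ⟨_, hT⟩ subset_rfl ⟨.na .imp_self, hab.1⟩
    rw [hw]
    exact ⟨hΔ.closed _ hb.1, hφ⟩

/-- An underivable consecution over `S` is refuted in the canonical model over `S`. -/
theorem exists_canonicalFrame_refutes {Ax S Γ : Set Fml} {φ : Fml} (hS : SubformulaClosed S)
    (hΓ : Γ ⊆ S) (hφ : φ ∈ S) (h : ¬ Deriv Ax Γ φ) :
    ∃ ne, ∃ w : (canonicalFrame Ax S ne).W,
      (∀ ψ ∈ Γ, (canonicalFrame Ax S ne).sat (canonicalVal Ax S ne) ψ w) ∧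
        ¬ (canonicalFrame Ax S ne).sat (canonicalVal Ax S ne) φ w := by
  obtain ⟨Δ, hΔ, hp, hn⟩ := exists_isPrimeTheory h
  refine ⟨⟨⟨_, hS.isCanonicalWorld hp⟩⟩, ⟨_, hS.isCanonicalWorld hp⟩, fun ψ hψ => ?_, fun hs => ?_⟩
  · exact (canonicalFrame_sat_iff hS _ (hΓ hψ) _).2 ⟨hΔ hψ, hΓ hψ⟩
  · exact hn ((canonicalFrame_sat_iff hS _ hφ _).1 hs).1

theorem canonicalVal_isUpset (Ax S : Set Fml) (ne : Nonempty {w // IsCanonicalWorld Ax S w}) :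
    (canonicalFrame Ax S ne).IsUpset (canonicalVal Ax S ne) :=
  fun _ _ _ hwv h => hwv h

theorem finite_canonicalFrame {Ax S : Set Fml} (hS : S.Finite)
    (ne : Nonempty {w // IsCanonicalWorld Ax S w}) : Finite (canonicalFrame Ax S ne).W := by
  refine Set.Finite.subset (hS.finite_subsets.prod hS.finite_subsets) fun w hw => ⟨?_, hw.subset⟩
  obtain ⟨Δ, -, h⟩ := hw.prime
  exact h.trans_subset Set.inter_subset_right

/-- `HLC♭` is strongly complete with respect to the class of flat
frames, and has the finite model property. -/
theorem hlc_flat_complete_and_fmp :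
    (∀ (Γ : Set Fml) (φ : Fml),
      (∀ F : FlatFrame, F.ValidCons Γ φ) → Deriv (∅ : Set Fml) Γ φ) ∧
    (∀ (Γ : Set Fml) (φ : Fml), Γ.Finite → ¬ Deriv (∅ : Set Fml) Γ φ →
      ∃ (F : FlatFrame) (V : Nat → F.W → Prop), Finite F.W ∧ F.IsUpset V ∧
        ∃ w : F.W, (∀ ψ ∈ Γ, F.sat V ψ w) ∧ ¬ F.sat V φ w) := by
  refine ⟨fun Γ φ h => ?_, fun Γ φ hfin h => ?_⟩
  · by_contra hn
    obtain ⟨ne, w, hΓ, hφ⟩ := exists_canonicalFrame_refutes (S := Set.univ)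
      (by constructor <;> simp) (Set.subset_univ _) (Set.mem_univ _) hn
    exact hφ (h _ _ (canonicalVal_isUpset _ _ ne) w hΓ)
  · have hsub : insert φ Γ ⊆ ⋃ χ ∈ insert φ Γ, χ.subformulas :=
      fun χ hχ => Set.mem_biUnion hχ χ.self_mem_subformulas
    obtain ⟨ne, hw⟩ := exists_canonicalFrame_refutes (SubformulaClosed.biUnion (insert φ Γ))
      ((Set.subset_insert _ _).trans hsub) (hsub (Set.mem_insert _ _)) h
    exact ⟨_, _, finite_canonicalFrame
      ((hfin.insert φ).biUnion fun χ _ => χ.finite_subformulas) ne,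
      canonicalVal_isUpset _ _ ne, hw⟩
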